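/- Lower bound on the instance-optimal competitive ratio for binary prediction: for each integer n ≥ 1 define the exact minimax regret f_n := n/2 − 2^{−n} ∑_{y∈{0,1}^n} min{∑_{t=1}^n y_t, n − ∑_{t=1}^n y_t}, and define γ_n as the infimum, over all predictors (a_t)_{t=1}^n with a_t : {0,1}^{t−1} → [0,1], of the supremum over y ∈ {0,1}^n of [∑_{t=1}^n |a_t(y_1,…,y_{t−1}) − y_t| − min{∑_{t=1}^n y_t, n − ∑_{t=1}^n y_t}] / min{(1/2)·c(y_1,…,y_{n−1}), f_n}. Then liminf_{n→∞} γ_n ≥ (1 − e^{−1/π} + 2·Q(√(2/π)))^{−1}, where Q(x) := (1/√(2π)) ∫_x^∞ e^{−t²/2} dt; numerically the right-hand side is approximately 1.4335. -/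

import Mathlib

/-- `extSeq n y` is the `{0,1}`-valued sequence on `ℕ` (indexed `1, …, n`)
corresponding to the bit vector `y : Fin n → Bool` (and `0` outside `[1, n]`). -/
def extSeq (n : ℕ) (y : Fin n → Bool) : ℕ → ℕ :=
  fun i => if h : 1 ≤ i ∧ i ≤ n then (if y ⟨i - 1, by omega⟩ then 1 else 0) else 0

/-- `leadCount t Y` is the lead-change count of the prefix `(Y 1, …, Y t)`:
the number of `0 ≤ j ≤ t` with `∑_{i=1}^j Y i = ∑_{i=1}^j (1 - Y i)`,
i.e. `2 ∑_{i=1}^j Y i = j` (note `j = 0` always counts). -/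
def leadCount (t : ℕ) (Y : ℕ → ℕ) : ℕ :=
  ((Finset.range (t + 1)).filter (fun j => 2 * ∑ i ∈ Finset.Icc 1 j, Y i = j)).card

/-- The exact minimax regret of horizon-`n` binary prediction:
`f n = n/2 - 2^{-n} ∑_{y ∈ {0,1}^n} min (#1s y) (n - #1s y)`. -/
noncomputable def minimaxRegret (n : ℕ) : ℝ :=
  (n : ℝ) / 2 - ((2 : ℝ) ^ n)⁻¹ * ∑ y : Fin n → Bool,
    min ((∑ t ∈ Finset.Icc 1 n, extSeq n y t : ℕ) : ℝ)
      ((n : ℝ) - (∑ t ∈ Finset.Icc 1 n, extSeq n y t : ℕ))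

/-- `gammaOpt n` is the best achievable competitive ratio against
`min (Reg(FTL, y)) (Reg(Cover, y)) = min ((1/2) c(y₁,…,y_{n-1})) (f n)`: the infimum,
over all predictors `a` with values in `[0,1]` depending only on the observed prefix,
of the supremum over `y ∈ {0,1}^n` of the ratio of the regret of `a` on `y` to
`min ((1/2) c(y₁,…,y_{n-1})) (f n)`. -/
noncomputable def gammaOpt (n : ℕ) : ℝ :=
  sInf { v : ℝ | ∃ a : ℕ → (ℕ → ℕ) → ℝ,
    (∀ t (y : ℕ → ℕ), a t y ∈ Set.Icc (0 : ℝ) 1) ∧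
    (∀ t (y y' : ℕ → ℕ), (∀ i ∈ Finset.Icc 1 (t - 1), y i = y' i) → a t y = a t y') ∧
    v = ⨆ y : Fin n → Bool,
      ((∑ t ∈ Finset.Icc 1 n, |a t (extSeq n y) - (extSeq n y t : ℝ)|)
          - min ((∑ t ∈ Finset.Icc 1 n, extSeq n y t : ℕ) : ℝ)
              ((n : ℝ) - (∑ t ∈ Finset.Icc 1 n, extSeq n y t : ℕ)))
        / min ((1 / 2) * (leadCount (n - 1) (extSeq n y) : ℝ)) (minimaxRegret n) }

/-- `Q x = (1/√(2π)) ∫_x^∞ e^{-t²/2} dt`, the standard Gaussian tail function. -/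
noncomputable def gaussQ (x : ℝ) : ℝ :=
  (Real.sqrt (2 * Real.pi))⁻¹ * ∫ t in Set.Ioi x, Real.exp (-t ^ 2 / 2)

open Filter Topology MeasureTheory ProbabilityTheory

section Walk

/-- The `±1` walk driven by the binary sequence `Y 1, Y 2, …`. -/
def walk (Y : ℕ → ℕ) (t : ℕ) : ℤ := ∑ i ∈ Finset.range t, (2 * (Y (i + 1) : ℤ) - 1)

/-- The number of times `j < n` at which the walk started at `d` is at the origin. -/
def visits (n : ℕ) (d : ℤ) (Y : ℕ → ℕ) : ℕ :=
  ((Finset.range n).filter (fun j => d + walk Y j = 0)).card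

@[simp] lemma walk_zero (Y : ℕ → ℕ) : walk Y 0 = 0 := rfl

lemma walk_succ (Y : ℕ → ℕ) (t : ℕ) : walk Y (t + 1) = walk Y t + (2 * (Y (t + 1) : ℤ) - 1) :=
  Finset.sum_range_succ _ _

lemma walk_eq (Y : ℕ → ℕ) (t : ℕ) : walk Y t = 2 * (∑ i ∈ Finset.Icc 1 t, Y i : ℕ) - t := by
  induction t with
  | zero => simp
  | succ t ih =>
    rw [walk_succ, ih, Finset.sum_Icc_succ_top (by omega)]
    push_cast
    ring

lemma leadCount_eq_visits (n : ℕ) (Y : ℕ → ℕ) : leadCount n Y = visits (n + 1) 0 Y := by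
  unfold leadCount visits
  congr 1
  refine Finset.filter_congr fun j _ => ?_
  rw [walk_eq]
  omega

lemma visits_succ_right (n : ℕ) (Y : ℕ → ℕ) :
    visits (n + 1) 0 Y = visits n 0 Y + if walk Y n = 0 then 1 else 0 := by
  unfold visits
  rw [Finset.range_add_one, Finset.filter_insert]
  split_ifs <;> simp_all

lemma extSeq_le_one (n : ℕ) (y : Fin n → Bool) (i : ℕ) : extSeq n y i ≤ 1 := by
  unfold extSeq
  split_ifs <;> simp

lemma extSeq_cons_one (n : ℕ) (b : Bool) (y : Fin n → Bool) :
    extSeq (n + 1) (Fin.cons b y) 1 = if b then 1 else 0 := by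
  simp [extSeq]

lemma extSeq_cons_succ (n : ℕ) (b : Bool) (y : Fin n → Bool) (i : ℕ) :
    extSeq (n + 1) (Fin.cons b y) (i + 2) = extSeq n y (i + 1) := by
  unfold extSeq
  by_cases h : i + 1 ≤ n
  · have h' : (⟨i + 2 - 1, by omega⟩ : Fin (n + 1)) = Fin.succ ⟨i, by omega⟩ := rfl
    rw [dif_pos (by omega), dif_pos (by omega), h', Fin.cons_succ]
    rfl
  · rw [dif_neg (by omega), dif_neg (by omega)]

lemma walk_cons (n : ℕ) (b : Bool) (y : Fin n → Bool) (j : ℕ) :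
    walk (extSeq (n + 1) (Fin.cons b y)) (j + 1) =
      (if b then 1 else -1) + walk (extSeq n y) j := by
  unfold walk
  rw [Finset.sum_range_succ', add_comm]
  congr 1
  · rw [extSeq_cons_one]
    cases b <;> simp
  · simp only [add_assoc, Nat.reduceAdd, extSeq_cons_succ]

lemma visits_cons (n : ℕ) (d : ℤ) (b : Bool) (y : Fin n → Bool) :
    visits (n + 1) d (extSeq (n + 1) (Fin.cons b y)) =
      (if d = 0 then 1 else 0) + visits n (d + if b then 1 else -1) (extSeq n y) := by
  unfold visits
  rw [Finset.card_filter, Finset.card_filter, Finset.sum_range_succ', add_comm]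
  simp only [walk_cons, walk_zero, add_zero, add_assoc]

end Walk

section CubeAverage

/-- The average of `F` over the cube `{0,1}^n`. -/
noncomputable def cubeAvg {E : Type*} [AddCommGroup E] [Module ℝ E] (n : ℕ)
    (F : (Fin n → Bool) → E) : E :=
  ((2 : ℝ) ^ n)⁻¹ • ∑ y, F y

variable {E : Type*} [AddCommGroup E] [Module ℝ E]

lemma cubeAvg_zero (F : (Fin 0 → Bool) → E) : cubeAvg 0 F = F Fin.elim0 := by
  simp [cubeAvg, Subsingleton.elim default Fin.elim0]

lemma cubeAvg_succ (n : ℕ) (F : (Fin (n + 1) → Bool) → E) :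
    cubeAvg (n + 1) F = (2 : ℝ)⁻¹ • (cubeAvg n (fun y => F (Fin.cons true y)) +
      cubeAvg n (fun y => F (Fin.cons false y))) := by
  unfold cubeAvg
  rw [← (Fin.consEquiv fun _ => Bool).sum_comp, Fintype.sum_prod_type, Fintype.sum_bool,
    ← smul_add, smul_smul]
  simp [Fin.consEquiv, pow_succ, mul_comm]

lemma cubeAvg_add (n : ℕ) (F G : (Fin n → Bool) → E) :
    cubeAvg n (fun y => F y + G y) = cubeAvg n F + cubeAvg n G := by
  simp [cubeAvg, Finset.sum_add_distrib]

lemma cubeAvg_const (n : ℕ) (c : E) : cubeAvg n (fun _ => c) = c := by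
  simp [cubeAvg, ← Nat.cast_smul_eq_nsmul ℝ, smul_smul]

lemma cubeAvg_sum {ι : Type*} (n : ℕ) (s : Finset ι) (F : ι → (Fin n → Bool) → E) :
    cubeAvg n (fun y => ∑ i ∈ s, F i y) = ∑ i ∈ s, cubeAvg n (F i) := by
  unfold cubeAvg
  rw [Finset.sum_comm, Finset.smul_sum]

lemma cubeAvg_const_mul (n : ℕ) (c : ℝ) (F : (Fin n → Bool) → ℝ) :
    cubeAvg n (fun y => c * F y) = c * cubeAvg n F := by
  simp [cubeAvg, ← Finset.mul_sum]
  ring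

lemma cubeAvg_mono (n : ℕ) {F G : (Fin n → Bool) → ℝ} (h : ∀ y, F y ≤ G y) :
    cubeAvg n F ≤ cubeAvg n G := by
  unfold cubeAvg
  simp only [smul_eq_mul]
  gcongr with y
  exact h y

end CubeAverage

section Hitting

/-- The probability that a simple random walk reaches level `r` within `n` steps. -/
noncomputable def hitProb : ℕ → ℕ → ℝ
  | _, 0 => 1
  | 0, _ + 1 => 0
  | n + 1, r + 1 => (hitProb n r + hitProb n (r + 2)) / 2

lemma hitProb_zero_right (n : ℕ) : hitProb n 0 = 1 := by
  cases n <;> rfl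

lemma hitProb_succ_succ (n r : ℕ) :
    hitProb (n + 1) (r + 1) = (hitProb n r + hitProb n (r + 2)) / 2 := rfl

lemma hitProb_nonneg (n r : ℕ) : 0 ≤ hitProb n r := by
  induction n generalizing r with
  | zero => cases r <;> simp [hitProb]
  | succ n ih =>
    cases r with
    | zero => simp [hitProb]
    | succ r => rw [hitProb_succ_succ]; linarith [ih r, ih (r + 2)]

lemma hitProb_le_succ (n r : ℕ) : hitProb n r ≤ hitProb (n + 1) r := by
  induction n generalizing r with
  | zero =>
    cases r with
    | zero => simp [hitProb]
    | succ r => exact hitProb_nonneg _ _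
  | succ n ih =>
    cases r with
    | zero => simp [hitProb]
    | succ r => rw [hitProb_succ_succ, hitProb_succ_succ]; linarith [ih r, ih (r + 2)]

lemma hitProb_le_cubeAvg (n r : ℕ) :
    hitProb n r ≤ cubeAvg n (fun y => if (r : ℤ) ≤ |walk (extSeq n y) n| then (1 : ℝ) else 0) := by
  induction n generalizing r with
  | zero =>
    rw [cubeAvg_zero]
    cases r with
    | zero => simp [hitProb]
    | succ r => simp only [hitProb]; split_ifs <;> simp
  | succ n ih =>
    cases r with
    | zero => simp [hitProb, cubeAvg_const]
    | succ r =>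
      rw [hitProb_succ_succ, cubeAvg_succ, ← cubeAvg_add, smul_eq_mul]
      have h := add_le_add (ih r) (ih (r + 2))
      rw [← cubeAvg_add] at h
      refine (div_le_div_of_nonneg_right (h.trans (cubeAvg_mono n fun y => ?_)) zero_le_two).trans
        (by rw [div_eq_inv_mul])
      simp only [walk_cons]
      generalize walk (extSeq n y) n = s
      rcases abs_cases s with ⟨hs, _⟩ | ⟨hs, _⟩ <;>
      rcases abs_cases (1 + s) with ⟨h1, _⟩ | ⟨h1, _⟩ <;>
      rcases abs_cases (-1 + s) with ⟨h2, _⟩ | ⟨h2, _⟩ <;>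
      simp only [hs, h1, h2, if_true, Bool.false_eq_true, if_false] <;> push_cast <;>
      split_ifs <;> first | omega | norm_num

lemma cubeAvg_min_visits_le (n k : ℕ) (d : ℤ) :
    cubeAvg n (fun y => ((min (visits n d (extSeq n y)) k : ℕ) : ℝ)) ≤
      ∑ r ∈ Finset.range k, hitProb n (d.natAbs + r) := by
  induction n generalizing k d with
  | zero =>
    rw [cubeAvg_zero]
    simpa [visits] using Finset.sum_nonneg fun r _ => hitProb_nonneg _ _
  | succ n ih =>
    rw [cubeAvg_succ, smul_eq_mul]
    simp only [visits_cons, if_true, Bool.false_eq_true, if_false]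
    by_cases hd : d = 0
    · subst hd
      cases k with
      | zero => simp [cubeAvg_const]
      | succ k =>
        have h1 := ih k 1
        have h2 := ih k (-1)
        have h3 : ∑ r ∈ Finset.range k, hitProb n (1 + r) ≤
            ∑ r ∈ Finset.range k, hitProb (n + 1) (r + 1) :=
          Finset.sum_le_sum fun r _ => by rw [add_comm]; exact hitProb_le_succ _ _
        rw [Finset.sum_range_succ']
        have h4 (e : ℤ) : cubeAvg n (fun y =>
            ((min (1 + visits n (0 + e) (extSeq n y)) (k + 1) : ℕ) : ℝ)) =
            1 + cubeAvg n (fun y => ((min (visits n e (extSeq n y)) k : ℕ) : ℝ)) := by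
          rw [← cubeAvg_const n (1 : ℝ), ← cubeAvg_add]
          congr 1
          ext y
          rw [zero_add, add_comm 1, min_add_add_right]
          push_cast
          ring
        simp only [if_true, h4]
        simp only [Int.natAbs_zero, zero_add, hitProb_zero_right, Int.natAbs_one,
          Int.natAbs_neg] at h1 h2 ⊢
        linarith
    · have h1 := ih k (d + 1)
      have h2 := ih k (d + -1)
      simp only [hd, if_false, zero_add]
      have h3 : ∑ r ∈ Finset.range k, hitProb (n + 1) (d.natAbs + r) =
          (∑ r ∈ Finset.range k, hitProb n ((d + 1).natAbs + r) +
            ∑ r ∈ Finset.range k, hitProb n ((d + -1).natAbs + r)) / 2 := by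
        rw [← Finset.sum_add_distrib, Finset.sum_div]
        refine Finset.sum_congr rfl fun r _ => ?_
        obtain ⟨m, hm⟩ : ∃ m, d.natAbs + r = m + 1 := ⟨d.natAbs + r - 1, by omega⟩
        rw [hm, hitProb_succ_succ]
        rcases lt_or_gt_of_ne hd with h | h
        · rw [show (d + 1).natAbs + r = m by omega, show (d + -1).natAbs + r = m + 2 by omega]
        · rw [show (d + 1).natAbs + r = m + 2 by omega, show (d + -1).natAbs + r = m by omega,
            add_comm]
      rw [h3]
      linarith

/-- The truncated expected number of lead changes is at most that of the final lead, plus one. -/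
lemma cubeAvg_min_visits_le_min_abs_walk (n : ℕ) {x : ℝ} (hx : 0 ≤ x) :
    cubeAvg n (fun y => min (visits n 0 (extSeq n y) : ℝ) x) ≤
      cubeAvg n (fun y => min |(walk (extSeq n y) n : ℝ)| x) + 1 := by
  set k := ⌈x⌉₊
  have hk : x ≤ k := Nat.le_ceil x
  have hk' : (k : ℝ) < x + 1 := Nat.ceil_lt_add_one hx
  calc cubeAvg n (fun y => min (visits n 0 (extSeq n y) : ℝ) x)
      ≤ cubeAvg n (fun y => ((min (visits n 0 (extSeq n y)) k : ℕ) : ℝ)) :=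
        cubeAvg_mono n fun y => by push_cast; exact min_le_min_left _ hk
    _ ≤ ∑ r ∈ Finset.range k, hitProb n r := by
        simpa using cubeAvg_min_visits_le n k 0
    _ ≤ ∑ r ∈ Finset.range k, cubeAvg n
          (fun y => if (r : ℤ) ≤ |walk (extSeq n y) n| then (1 : ℝ) else 0) :=
        Finset.sum_le_sum fun r _ => hitProb_le_cubeAvg n r
    _ ≤ cubeAvg n (fun y => min |(walk (extSeq n y) n : ℝ)| x + 1) := by
        rw [← cubeAvg_sum]
        refine cubeAvg_mono n fun y => ?_
        generalize walk (extSeq n y) n = s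
        rw [Finset.sum_boole, ← min_add_add_right]
        refine le_min ?_ ?_
        · have : ((Finset.range k).filter fun r : ℕ => (r : ℤ) ≤ |s|).card ≤ s.natAbs + 1 := by
            rw [← Finset.card_range (s.natAbs + 1)]
            refine Finset.card_le_card fun r hr => ?_
            simp only [Finset.mem_filter, Finset.mem_range, Int.abs_eq_natAbs] at hr ⊢
            omega
          calc _ ≤ ((s.natAbs + 1 : ℕ) : ℝ) := by exact_mod_cast this
            _ = |(s : ℝ)| + 1 := by push_cast; rw [Nat.cast_natAbs]; push_cast; ring
        · have := (Finset.card_filter_le (Finset.range k) fun r : ℕ => (r : ℤ) ≤ |s|)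
          rw [Finset.card_range] at this
          have : (((Finset.range k).filter fun r : ℕ => (r : ℤ) ≤ |s|).card : ℝ) ≤ k := by
            exact_mod_cast this
          linarith
    _ = _ := by rw [cubeAvg_add, cubeAvg_const]

end Hitting

section CentralLimit

/-- The law of the rescaled walk `walk n / √n` under the uniform measure on the cube. -/
noncomputable def walkLaw (n : ℕ) : Measure ℝ :=
  ∑ y : Fin n → Bool, ENNReal.ofReal ((2 : ℝ) ^ n)⁻¹ •
    Measure.dirac ((√n)⁻¹ * (walk (extSeq n y) n : ℝ))

instance (n : ℕ) : IsProbabilityMeasure (walkLaw n) where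
  measure_univ := by
    simp only [walkLaw, Measure.coe_finsetSum, Finset.sum_apply, Measure.smul_apply, measure_univ,
      smul_eq_mul, mul_one, Finset.sum_const, Finset.card_univ, Fintype.card_fun, Fintype.card_fin,
      Fintype.card_bool, nsmul_eq_mul]
    rw [ENNReal.ofReal_inv_of_pos (by positivity), ENNReal.ofReal_pow (by norm_num)]
    push_cast
    rw [ENNReal.ofReal_ofNat]
    exact ENNReal.mul_inv_cancel (by simp) (by simp)

lemma integral_walkLaw {E : Type*} [NormedAddCommGroup E] [NormedSpace ℝ E] [CompleteSpace E]
    (n : ℕ) (f : ℝ → E) :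
    ∫ x, f x ∂walkLaw n = cubeAvg n (fun y => f ((√n)⁻¹ * (walk (extSeq n y) n : ℝ))) := by
  unfold walkLaw cubeAvg
  rw [integral_finsetSum_measure]
  · simp_rw [integral_smul_measure, integral_dirac]
    rw [Finset.smul_sum]
    rw [ENNReal.toReal_ofReal (by positivity)]
  · intro y _
    exact (integrable_dirac (by simp)).smul_measure (by simp)

lemma cubeAvg_exp_walk (n : ℕ) (u : ℝ) :
    cubeAvg n (fun y => Complex.exp (u * (walk (extSeq n y) n : ℝ) * Complex.I)) =
      Complex.cos u ^ n := by
  induction n with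
  | zero => simp [cubeAvg_zero]
  | succ n ih =>
    have h (c : ℂ) : cubeAvg n (fun y =>
        c * Complex.exp (u * (walk (extSeq n y) n : ℝ) * Complex.I)) = c * Complex.cos u ^ n := by
      rw [← ih]
      simp only [cubeAvg, ← Finset.mul_sum, mul_smul_comm]
    rw [cubeAvg_succ]
    simp only [walk_cons, if_true, Bool.false_eq_true, if_false]
    push_cast at h ⊢
    have h1 (w : ℂ) : Complex.exp (u * (1 + w) * Complex.I) =
        Complex.exp (u * Complex.I) * Complex.exp (u * w * Complex.I) := by
      rw [← Complex.exp_add]; ring_nf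
    have h2 (w : ℂ) : Complex.exp (u * (-1 + w) * Complex.I) =
        Complex.exp (-u * Complex.I) * Complex.exp (u * w * Complex.I) := by
      rw [← Complex.exp_add]; ring_nf
    simp only [h1, h2, h]
    rw [← add_mul, ← Complex.two_cos, pow_succ, Complex.real_smul]
    push_cast
    ring

lemma charFun_walkLaw (n : ℕ) (t : ℝ) :
    charFun (walkLaw n) t = Complex.cos ((√n)⁻¹ * t : ℝ) ^ n := by
  rw [charFun_apply_real, integral_walkLaw, ← cubeAvg_exp_walk]
  congr 1
  ext y
  push_cast
  ring_nf

lemma tendsto_charFun_walkLaw (t : ℝ) :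
    Tendsto (fun n : ℕ => charFun (walkLaw n) t) atTop (𝓝 (Complex.exp (-t ^ 2 / 2))) := by
  have h := tendsto_charFun_inv_sqrt_mul_pow (P := walkLaw 1) (X := id) aemeasurable_id
    (by simp [integral_walkLaw, cubeAvg_succ, cubeAvg_zero, walk_cons])
    (by simp [integral_walkLaw, cubeAvg_succ, cubeAvg_zero, walk_cons]; norm_num) t
  simpa [charFun_walkLaw] using h

lemma tendsto_walkLaw :
    Tendsto (β := ProbabilityMeasure ℝ) (fun n => ⟨walkLaw n, inferInstance⟩) atTop
      (𝓝 ⟨gaussianReal 0 1, inferInstance⟩) := by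
  refine ProbabilityMeasure.tendsto_iff_tendsto_charFun.2 fun t => ?_
  simpa [charFun_gaussianReal, neg_div] using tendsto_charFun_walkLaw t

lemma tendsto_cubeAvg_min_abs_walk {c : ℝ} (hc : 0 ≤ c) :
    Tendsto (fun n : ℕ => cubeAvg n (fun y => min ((√n)⁻¹ * |(walk (extSeq n y) n : ℝ)|) c)) atTop
      (𝓝 (∫ x, min |x| c ∂gaussianReal 0 1)) := by
  have h := ProbabilityMeasure.tendsto_iff_forall_integral_tendsto.1 tendsto_walkLaw
    (BoundedContinuousFunction.ofNormedAddCommGroup (fun x : ℝ => min |x| c) (by fun_prop) c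
      fun x => by
        rw [Real.norm_of_nonneg (le_min (abs_nonneg x) hc)]
        exact min_le_right _ _)
  simpa [integral_walkLaw, abs_mul, abs_of_nonneg (Real.sqrt_nonneg _)] using h

end CentralLimit

section Gaussian

lemma hasDerivAt_neg_exp_neg_sq_div_two (x : ℝ) :
    HasDerivAt (fun x : ℝ => -Real.exp (-x ^ 2 / 2)) (x * Real.exp (-x ^ 2 / 2)) x := by
  have h : HasDerivAt (fun x : ℝ => -x ^ 2 / 2) (-x) x :=
    ((hasDerivAt_pow 2 x).neg.div_const 2).congr_deriv (by push_cast; ring)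
  exact h.exp.neg.congr_deriv (by ring)

lemma integrable_exp_neg_sq_div_two : Integrable (fun x : ℝ => Real.exp (-x ^ 2 / 2)) := by
  convert integrable_exp_neg_mul_sq (b := 1 / 2) (by norm_num) using 3
  ring

/-- The truncated first absolute moment of the standard Gaussian. -/
lemma integral_min_abs_gaussianReal {c : ℝ} (hc : 0 ≤ c) :
    ∫ x, min |x| c ∂gaussianReal 0 1 =
      √(2 / Real.pi) * (1 - Real.exp (-c ^ 2 / 2)) + 2 * c * gaussQ c := by
  have hs : (√(2 * Real.pi))⁻¹ * 2 = √(2 / Real.pi) := by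
    have := Real.pi_pos
    rw [Real.sqrt_mul zero_le_two, Real.sqrt_div zero_le_two]
    field_simp
    rw [Real.sq_sqrt zero_le_two]
  have hint : IntegrableOn (fun x : ℝ => min x c * Real.exp (-x ^ 2 / 2)) (Set.Ioi 0) := by
    refine Integrable.mono' (g := fun x => c * Real.exp (-x ^ 2 / 2))
      (integrable_exp_neg_sq_div_two.const_mul c).integrableOn
      (by fun_prop) ?_
    refine (ae_restrict_iff' measurableSet_Ioi).2 (ae_of_all _ fun x hx => ?_)
    rw [Real.norm_of_nonneg (mul_nonneg (le_min (le_of_lt hx) hc) (Real.exp_nonneg _))]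
    gcongr
    exact min_le_right _ _
  have h1 : ∫ x in Set.Ioc 0 c, min x c * Real.exp (-x ^ 2 / 2) = 1 - Real.exp (-c ^ 2 / 2) := by
    have : ∫ x in Set.Ioc 0 c, min x c * Real.exp (-x ^ 2 / 2) =
        ∫ x in Set.Ioc 0 c, x * Real.exp (-x ^ 2 / 2) :=
      setIntegral_congr_fun measurableSet_Ioc fun x hx => by simp [min_eq_left hx.2]
    rw [this, ← intervalIntegral.integral_of_le hc,
      intervalIntegral.integral_eq_sub_of_hasDerivAt
        (fun x _ => hasDerivAt_neg_exp_neg_sq_div_two x)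
        (Continuous.intervalIntegrable (by fun_prop) _ _)]
    simp
    ring
  have h2 : ∫ x in Set.Ioi c, min x c * Real.exp (-x ^ 2 / 2) =
      c * ∫ x in Set.Ioi c, Real.exp (-x ^ 2 / 2) := by
    rw [← integral_const_mul]
    exact setIntegral_congr_fun measurableSet_Ioi fun x hx => by
      simp [min_eq_right (le_of_lt (Set.mem_Ioi.1 hx))]
  calc ∫ x, min |x| c ∂gaussianReal 0 1
      = ∫ x, (√(2 * Real.pi))⁻¹ * (min |x| c * Real.exp (-|x| ^ 2 / 2)) := by
        rw [integral_gaussianReal_eq_integral_smul one_ne_zero]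
        congr 1
        ext x
        simp [gaussianPDFReal]
        ring
    _ = (√(2 * Real.pi))⁻¹ * (2 * ∫ x in Set.Ioi 0, min x c * Real.exp (-x ^ 2 / 2)) := by
        rw [integral_const_mul, integral_comp_abs (f := fun x => min x c * Real.exp (-x ^ 2 / 2))]
    _ = (√(2 * Real.pi))⁻¹ * (2 * (1 - Real.exp (-c ^ 2 / 2) +
          c * ∫ x in Set.Ioi c, Real.exp (-x ^ 2 / 2))) := by
        rw [← Set.Ioc_union_Ioi_eq_Ioi hc, setIntegral_union (Set.Ioc_disjoint_Ioi le_rfl)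
          measurableSet_Ioi (hint.mono_set Set.Ioc_subset_Ioi_self)
          (hint.mono_set (Set.Ioi_subset_Ioi hc)), h1, h2]
    _ = _ := by
        rw [gaussQ, ← hs]
        ring

lemma gaussQ_nonneg (x : ℝ) : 0 ≤ gaussQ x :=
  mul_nonneg (by positivity) (integral_nonneg fun _ => Real.exp_nonneg _)

/-- The rescaled expected final lead is eventually above any level below `√(2/π)`. -/
lemma eventually_le_cubeAvg_abs_walk {c : ℝ} (hc : c < √(2 / Real.pi)) :
    ∀ᶠ n : ℕ in atTop, c ≤ (√n)⁻¹ * cubeAvg n (fun y => |(walk (extSeq n y) n : ℝ)|) := by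
  have hlim : Tendsto (fun M : ℝ => √(2 / Real.pi) * (1 - Real.exp (-M ^ 2 / 2))) atTop
      (𝓝 (√(2 / Real.pi) * (1 - 0))) := by
    refine (tendsto_const_nhds.sub (Real.tendsto_exp_atBot.comp ?_)).const_mul _
    have : Tendsto (fun M : ℝ => -(M ^ 2 / 2)) atTop atBot :=
      tendsto_neg_atTop_atBot.comp ((tendsto_pow_atTop two_ne_zero).atTop_div_const two_pos)
    simpa [neg_div] using this
  rw [sub_zero, mul_one] at hlim
  obtain ⟨M, hM, hM0⟩ := ((hlim.eventually (lt_mem_nhds hc)).and (eventually_ge_atTop 0)).exists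
  have hG : c < ∫ x, min |x| M ∂gaussianReal 0 1 := by
    rw [integral_min_abs_gaussianReal hM0]
    have := mul_nonneg (mul_nonneg zero_le_two hM0) (gaussQ_nonneg M)
    linarith
  filter_upwards [(tendsto_cubeAvg_min_abs_walk hM0).eventually (lt_mem_nhds hG)] with n hn
  refine hn.le.trans ?_
  rw [← cubeAvg_const_mul]
  exact cubeAvg_mono n fun y => min_le_left _ _

end Gaussian

section Regret

lemma min_sum_extSeq_eq (n : ℕ) (y : Fin n → Bool) :
    min ((∑ t ∈ Finset.Icc 1 n, extSeq n y t : ℕ) : ℝ)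
      ((n : ℝ) - (∑ t ∈ Finset.Icc 1 n, extSeq n y t : ℕ)) =
      n / 2 - |(walk (extSeq n y) n : ℝ)| / 2 := by
  rw [walk_eq]
  push_cast
  generalize (∑ t ∈ Finset.Icc 1 n, (extSeq n y t : ℝ)) = s
  rcases le_total s (n - s) with h | h
  · rw [min_eq_left h, abs_of_nonpos (by linarith)]
    ring
  · rw [min_eq_right h, abs_of_nonneg (by linarith)]
    ring

lemma minimaxRegret_eq (n : ℕ) :
    minimaxRegret n = cubeAvg n (fun y => |(walk (extSeq n y) n : ℝ)|) / 2 := by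
  have h : minimaxRegret n = n / 2 - cubeAvg n (fun y =>
      n / 2 + (-(1 / 2)) * |(walk (extSeq n y) n : ℝ)|) := by
    rw [minimaxRegret, cubeAvg, smul_eq_mul]
    congr 3
    ext y
    rw [min_sum_extSeq_eq]
    ring
  rw [h, cubeAvg_add, cubeAvg_const, cubeAvg_const_mul]
  ring

lemma extSeq_update_not_of_ne (n : ℕ) (y : Fin n → Bool) (j : Fin n) (i : ℕ) (hi : i ≠ j + 1) :
    extSeq n (Function.update y j (!y j)) i = extSeq n y i := by
  unfold extSeq
  split_ifs with h h1 h2 h2 <;> try rfl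
  all_goals
    rw [Function.update_of_ne (by rw [ne_eq, Fin.ext_iff]; simp only; omega)] at h1
    contradiction

lemma extSeq_update_not_self (n : ℕ) (y : Fin n → Bool) (j : Fin n) :
    (extSeq n (Function.update y j (!y j)) (j + 1) : ℝ) = 1 - extSeq n y (j + 1) := by
  have h : 1 ≤ (j : ℕ) + 1 ∧ (j : ℕ) + 1 ≤ n := by omega
  cases hy : y j <;> simp [extSeq, hy]

/-- Every predictor has average loss `n / 2` over the cube. -/
lemma cubeAvg_loss (n : ℕ) (a : ℕ → (ℕ → ℕ) → ℝ)
    (ha : ∀ t (y : ℕ → ℕ), a t y ∈ Set.Icc (0 : ℝ) 1)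
    (hpre : ∀ t (y y' : ℕ → ℕ), (∀ i ∈ Finset.Icc 1 (t - 1), y i = y' i) → a t y = a t y') :
    cubeAvg n (fun y => ∑ t ∈ Finset.Icc 1 n, |a t (extSeq n y) - (extSeq n y t : ℝ)|) = n / 2 := by
  have key : ∀ t ∈ Finset.Icc 1 n,
      cubeAvg n (fun y => |a t (extSeq n y) - (extSeq n y t : ℝ)|) = 1 / 2 := by
    intro t ht
    rw [Finset.mem_Icc] at ht
    obtain ⟨j, rfl⟩ : ∃ j : Fin n, t = j + 1 := ⟨⟨t - 1, by omega⟩, by simp; omega⟩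
    have hinv : Function.Involutive fun y : Fin n → Bool => Function.update y j (!y j) := by
      intro y
      simp
    have hflip : ∀ F : (Fin n → Bool) → ℝ,
        cubeAvg n (fun y => F (Function.update y j (!y j))) = cubeAvg n F := fun F => by
      unfold cubeAvg
      congr 1
      exact Equiv.sum_comp hinv.toPerm F
    have hadd := cubeAvg_add n (fun y => |a (j + 1) (extSeq n y) - (extSeq n y (j + 1) : ℝ)|)
      (fun y => |a (j + 1) (extSeq n (Function.update y j (!y j))) -
        (extSeq n (Function.update y j (!y j)) (j + 1) : ℝ)|)
    rw [hflip fun y => |a (j + 1) (extSeq n y) - (extSeq n y (j + 1) : ℝ)|] at hadd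
    have hone : ∀ y, |a (j + 1) (extSeq n y) - (extSeq n y (j + 1) : ℝ)| +
        |a (j + 1) (extSeq n (Function.update y j (!y j))) -
          (extSeq n (Function.update y j (!y j)) (j + 1) : ℝ)| = 1 := by
      intro y
      rw [extSeq_update_not_self, hpre (j + 1) (extSeq n (Function.update y j (!y j))) (extSeq n y)
        fun i hi => extSeq_update_not_of_ne n y j i (by rw [Finset.mem_Icc] at hi; omega)]
      obtain ⟨h0, h1⟩ := ha (j + 1) (extSeq n y)
      have hle := extSeq_le_one n y (j + 1)
      rcases Nat.le_one_iff_eq_zero_or_eq_one.1 hle with h | h <;> rw [h] <;> push_cast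
      · rw [abs_of_nonneg (by linarith), abs_of_nonpos (by linarith)]
        ring
      · rw [abs_of_nonpos (by linarith), abs_of_nonneg (by linarith)]
        ring
    simp only [hone, cubeAvg_const] at hadd
    linarith
  rw [cubeAvg_sum, Finset.sum_congr rfl key]
  simp
  ring

/-- The competitive ratio attained by the predictor `a` at horizon `n`. -/
noncomputable def competitiveRatio (n : ℕ) (a : ℕ → (ℕ → ℕ) → ℝ) : ℝ :=
  ⨆ y : Fin n → Bool,
    ((∑ t ∈ Finset.Icc 1 n, |a t (extSeq n y) - (extSeq n y t : ℝ)|)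
        - min ((∑ t ∈ Finset.Icc 1 n, extSeq n y t : ℕ) : ℝ)
            ((n : ℝ) - (∑ t ∈ Finset.Icc 1 n, extSeq n y t : ℕ)))
      / min ((1 / 2) * (leadCount (n - 1) (extSeq n y) : ℝ)) (minimaxRegret n)

lemma one_le_leadCount (n : ℕ) (Y : ℕ → ℕ) : 1 ≤ leadCount n Y :=
  Finset.card_pos.2 ⟨0, by simp⟩

lemma min_leadCount_pos {n : ℕ} (hf : 0 < minimaxRegret n) (Y : ℕ → ℕ) :
    0 < min ((1 / 2) * (leadCount (n - 1) Y : ℝ)) (minimaxRegret n) := by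
  have : (1 : ℝ) ≤ leadCount (n - 1) Y := by exact_mod_cast one_le_leadCount _ _
  exact lt_min (by linarith) hf

lemma minimaxRegret_le_competitiveRatio_mul {n : ℕ} (hf : 0 < minimaxRegret n)
    (a : ℕ → (ℕ → ℕ) → ℝ) (ha : ∀ t (y : ℕ → ℕ), a t y ∈ Set.Icc (0 : ℝ) 1)
    (hpre : ∀ t (y y' : ℕ → ℕ), (∀ i ∈ Finset.Icc 1 (t - 1), y i = y' i) → a t y = a t y') :
    minimaxRegret n ≤ competitiveRatio n a * cubeAvg n (fun y =>
      min ((1 / 2) * (leadCount (n - 1) (extSeq n y) : ℝ)) (minimaxRegret n)) := by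
  have hloss := cubeAvg_loss n a ha hpre
  have hreg : cubeAvg n (fun y =>
      ((∑ t ∈ Finset.Icc 1 n, |a t (extSeq n y) - (extSeq n y t : ℝ)|) +
        ((-(n / 2) + (1 / 2) * |(walk (extSeq n y) n : ℝ)|)))) = minimaxRegret n := by
    rw [cubeAvg_add, hloss, cubeAvg_add, cubeAvg_const, cubeAvg_const_mul, minimaxRegret_eq]
    ring
  rw [← cubeAvg_const_mul, ← hreg]
  refine cubeAvg_mono n fun y => ?_
  rw [hreg]
  have h := le_ciSup (f := fun y : Fin n → Bool =>
    ((∑ t ∈ Finset.Icc 1 n, |a t (extSeq n y) - (extSeq n y t : ℝ)|)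
        - min ((∑ t ∈ Finset.Icc 1 n, extSeq n y t : ℕ) : ℝ)
            ((n : ℝ) - (∑ t ∈ Finset.Icc 1 n, extSeq n y t : ℕ)))
      / min ((1 / 2) * (leadCount (n - 1) (extSeq n y) : ℝ)) (minimaxRegret n))
    (Set.finite_range _).bddAbove y
  rw [div_le_iff₀ (min_leadCount_pos hf _), min_sum_extSeq_eq] at h
  refine le_trans (le_of_eq ?_) h
  ring

lemma gammaOpt_eq (n : ℕ) :
    gammaOpt n = sInf { v : ℝ | ∃ a : ℕ → (ℕ → ℕ) → ℝ,
      (∀ t (y : ℕ → ℕ), a t y ∈ Set.Icc (0 : ℝ) 1) ∧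
      (∀ t (y y' : ℕ → ℕ), (∀ i ∈ Finset.Icc 1 (t - 1), y i = y' i) → a t y = a t y') ∧
      v = competitiveRatio n a } := rfl

lemma minimaxRegret_div_le_competitiveRatio {n : ℕ} (hn : 1 ≤ n) (hf : 0 < minimaxRegret n)
    (a : ℕ → (ℕ → ℕ) → ℝ) (ha : ∀ t (y : ℕ → ℕ), a t y ∈ Set.Icc (0 : ℝ) 1)
    (hpre : ∀ t (y y' : ℕ → ℕ), (∀ i ∈ Finset.Icc 1 (t - 1), y i = y' i) → a t y = a t y') :
    2 * minimaxRegret n / (cubeAvg n (fun y =>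
      min |(walk (extSeq n y) n : ℝ)| (2 * minimaxRegret n)) + 1) ≤ competitiveRatio n a := by
  have h := minimaxRegret_le_competitiveRatio_mul hf a ha hpre
  have hv := cubeAvg_min_visits_le_min_abs_walk n (x := 2 * minimaxRegret n) (by linarith)
  have hhalf : cubeAvg n (fun y =>
      min ((1 / 2) * (leadCount (n - 1) (extSeq n y) : ℝ)) (minimaxRegret n)) =
      (1 / 2) * cubeAvg n (fun y =>
        min (visits n 0 (extSeq n y) : ℝ) (2 * minimaxRegret n)) := by
    rw [← cubeAvg_const_mul]
    congr 1
    ext y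
    rw [leadCount_eq_visits, Nat.sub_add_cancel hn, mul_min_of_nonneg _ _ (by norm_num)]
    ring_nf
  have hpos : 0 < cubeAvg n (fun y =>
      min |(walk (extSeq n y) n : ℝ)| (2 * minimaxRegret n)) + 1 := by
    have := cubeAvg_mono n (F := fun _ => (0 : ℝ))
      (G := fun y => min |(walk (extSeq n y) n : ℝ)| (2 * minimaxRegret n))
      fun y => le_min (abs_nonneg _) (by linarith)
    rw [cubeAvg_const] at this
    linarith
  rw [hhalf] at h
  have hA : 0 ≤ cubeAvg n (fun y =>
      min (visits n 0 (extSeq n y) : ℝ) (2 * minimaxRegret n)) := by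
    have := cubeAvg_mono n (F := fun _ => (0 : ℝ))
      (G := fun y => min (visits n 0 (extSeq n y) : ℝ) (2 * minimaxRegret n))
      fun y => le_min (Nat.cast_nonneg _) (by linarith)
    rwa [cubeAvg_const] at this
  have hr : 0 ≤ competitiveRatio n a := by
    by_contra! hneg
    nlinarith
  rw [div_le_iff₀ hpos]
  nlinarith

end Regret

section SwitchingPredictor

/-- The bias towards `1`, after `t` rounds, of the predictor that follows the leader until the
number of ties exceeds `m` and descends the potential `√(m² + d²)` of the lead `d` from then on. -/
noncomputable def switchBias (m : ℝ) (t : ℕ) (Y : ℕ → ℕ) : ℝ :=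
  if (visits (t + 1) 0 Y : ℝ) ≤ m then ((walk Y t).sign : ℝ)
  else walk Y t / √(m ^ 2 + (walk Y t : ℝ) ^ 2)

lemma abs_switchBias_le_one (m : ℝ) (t : ℕ) (Y : ℕ → ℕ) : |switchBias m t Y| ≤ 1 := by
  unfold switchBias
  split_ifs
  · rcases lt_trichotomy (walk Y t) 0 with h | h | h
    · simp [Int.sign_eq_neg_one_of_neg h]
    · simp [h]
    · simp [Int.sign_eq_one_of_pos h]
  · rw [abs_div, abs_of_nonneg (Real.sqrt_nonneg _)]
    refine div_le_one_of_le₀ ?_ (Real.sqrt_nonneg _)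
    exact Real.abs_le_sqrt (by nlinarith [sq_nonneg m])

lemma walk_congr {Y Y' : ℕ → ℕ} {t : ℕ} (h : ∀ i ∈ Finset.Icc 1 t, Y i = Y' i) :
    walk Y t = walk Y' t :=
  Finset.sum_congr rfl fun i hi => by
    rw [h (i + 1) (by rw [Finset.mem_range] at hi; rw [Finset.mem_Icc]; omega)]

lemma switchBias_congr (m : ℝ) {Y Y' : ℕ → ℕ} {t : ℕ} (h : ∀ i ∈ Finset.Icc 1 t, Y i = Y' i) :
    switchBias m t Y = switchBias m t Y' := by
  have hv : visits (t + 1) 0 Y = visits (t + 1) 0 Y' := by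
    unfold visits
    congr 1
    refine Finset.filter_congr fun j hj => ?_
    rw [Finset.mem_range] at hj
    rw [walk_congr fun i hi => h i (Finset.Icc_subset_Icc_right (by omega) hi)]
  unfold switchBias
  rw [hv, walk_congr h]

lemma sqrt_potential_add_le {m : ℝ} (hm : 0 < m) (d : ℝ) {x : ℝ} (hx : x ^ 2 = 1) :
    √(m ^ 2 + (d + x) ^ 2) ≤
      √(m ^ 2 + d ^ 2) + d / √(m ^ 2 + d ^ 2) * x + 1 / (2 * m) := by
  have hs2 : √(m ^ 2 + d ^ 2) ^ 2 = m ^ 2 + d ^ 2 := Real.sq_sqrt (by positivity)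
  have hms : m ≤ √(m ^ 2 + d ^ 2) := Real.le_sqrt_of_sq_le (by nlinarith [sq_nonneg d])
  set s := √(m ^ 2 + d ^ 2)
  have hs : 0 < s := by linarith
  have h1 : 1 / (2 * s) ≤ 1 / (2 * m) := by gcongr
  have h2 : √(m ^ 2 + (d + x) ^ 2) ≤ s + d / s * x + 1 / (2 * s) := by
    have key : s + d / s * x + 1 / (2 * s) = (2 * s ^ 2 + 2 * d * x + 1) / (2 * s) := by
      field_simp
    refine Real.sqrt_le_iff.2 ⟨?_, ?_⟩
    · rw [key]
      refine div_nonneg ?_ (by linarith)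
      rw [hs2]
      nlinarith [sq_nonneg (d + x), sq_nonneg m, sq_nonneg d]
    · have : m ^ 2 + (d + x) ^ 2 = s ^ 2 + 2 * d * x + 1 := by rw [hs2]; linear_combination hx
      rw [key, this, div_pow, le_div_iff₀ (by positivity)]
      nlinarith [sq_nonneg (2 * d * x + 1)]
  linarith

lemma le_sum_switchBias {m : ℝ} (hm : 0 < m) {Y : ℕ → ℕ} (hY : ∀ i, Y i ≤ 1) (t : ℕ) :
    (if (visits t 0 Y : ℝ) ≤ m then |(walk Y t : ℝ)| - visits t 0 Y
      else √(m ^ 2 + (walk Y t : ℝ) ^ 2) - 2 * m - t * (1 / (2 * m))) ≤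
      ∑ i ∈ Finset.range t, switchBias m i Y * (2 * (Y (i + 1) : ℝ) - 1) := by
  induction t with
  | zero => simp [visits, hm.le]
  | succ t ih =>
    rw [Finset.sum_range_succ]
    obtain ⟨x, hx, hx'⟩ : ∃ x : ℤ, (x = 1 ∨ x = -1) ∧ 2 * (Y (t + 1) : ℤ) - 1 = x := by
      rcases Nat.le_one_iff_eq_zero_or_eq_one.1 (hY (t + 1)) with h | h <;> simp [h]
    have hxr : 2 * (Y (t + 1) : ℝ) - 1 = x := by exact_mod_cast hx'
    rw [walk_succ, hx', hxr]
    have hvis := visits_succ_right t Y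
    have hbias : switchBias m t Y = if (visits (t + 1) 0 Y : ℝ) ≤ m then ((walk Y t).sign : ℝ)
      else walk Y t / √(m ^ 2 + (walk Y t : ℝ) ^ 2) := rfl
    rw [hbias]
    generalize walk Y t = d at *
    by_cases h : (visits (t + 1) 0 Y : ℝ) ≤ m
    · have ht : (visits t 0 Y : ℝ) ≤ m :=
        le_trans (by rw [hvis]; push_cast; split_ifs <;> simp) h
      rw [if_pos ht] at ih
      rw [if_pos h, if_pos h]
      have hz : |((d + x : ℤ) : ℝ)| - visits (t + 1) 0 Y = |(d : ℝ)| - visits t 0 Y +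
          (d.sign : ℝ) * x := by
        have hz' : |d + x| - visits (t + 1) 0 Y = |d| - visits t 0 Y + d.sign * x := by
          rw [hvis]
          rcases lt_trichotomy d 0 with hd | hd | hd
          · rw [Int.sign_eq_neg_one_of_neg hd, abs_of_neg hd, abs_of_nonpos (by omega),
              if_neg hd.ne]
            push_cast
            ring
          · subst hd
            rcases hx with rfl | rfl <;> simp
          · rw [Int.sign_eq_one_of_pos hd, abs_of_pos hd, abs_of_nonneg (by omega),
              if_neg hd.ne']
            push_cast
            ring
        exact_mod_cast hz'
      linarith
    · rw [if_neg h, if_neg h]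
      have hpot := sqrt_potential_add_le hm (d : ℝ) (x := (x : ℝ))
        (by rcases hx with rfl | rfl <;> simp)
      have hprev : √(m ^ 2 + (d : ℝ) ^ 2) - 2 * m - t * (1 / (2 * m)) ≤
          ∑ i ∈ Finset.range t, switchBias m i Y * (2 * (Y (i + 1) : ℝ) - 1) := by
        refine le_trans ?_ ih
        split_ifs with ht
        · have hd : d = 0 := by
            by_contra hd
            rw [if_neg hd, add_zero] at hvis
            exact h (hvis ▸ ht)
          have : 0 ≤ t * (1 / (2 * m)) := by positivity
          subst hd
          simp only [Int.cast_zero, abs_zero, ne_eq, OfNat.ofNat_ne_zero, not_false_eq_true,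
            zero_pow, add_zero, Real.sqrt_sq hm.le]
          linarith
        · exact le_rfl
      push_cast
      linarith

lemma loss_switchBias {m : ℝ} {Y : ℕ → ℕ} (hY : ∀ i, Y i ≤ 1) (n : ℕ) :
    ∑ t ∈ Finset.Icc 1 n, |(1 + switchBias m (t - 1) Y) / 2 - (Y t : ℝ)| =
      n / 2 - (∑ i ∈ Finset.range n, switchBias m i Y * (2 * (Y (i + 1) : ℝ) - 1)) / 2 := by
  induction n with
  | zero => simp
  | succ n ih =>
    rw [Finset.sum_Icc_succ_top (by omega), ih, Finset.sum_range_succ, Nat.add_sub_cancel]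
    obtain ⟨h1, h2⟩ := abs_le.1 (abs_switchBias_le_one m n Y)
    rcases Nat.le_one_iff_eq_zero_or_eq_one.1 (hY (n + 1)) with h | h <;> rw [h] <;> push_cast
    · rw [abs_of_nonneg (by linarith)]
      ring
    · rw [abs_of_nonpos (by linarith)]
      ring

lemma gammaOpt_le_of_sqrt_le {n : ℕ} (hn : 1 ≤ n) {ε : ℝ} (hε : 0 < ε)
    (hf : ε * √n ≤ minimaxRegret n) : gammaOpt n ≤ 5 / 2 + 5 / 4 / ε := by
  have hm : 0 < √(n : ℝ) := Real.sqrt_pos.2 (by exact_mod_cast hn)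
  have hf0 : 0 < minimaxRegret n := lt_of_lt_of_le (by positivity) hf
  have ha : ∀ t (y : ℕ → ℕ), (1 + switchBias √n (t - 1) y) / 2 ∈ Set.Icc (0 : ℝ) 1 := by
    intro t y
    obtain ⟨h1, h2⟩ := abs_le.1 (abs_switchBias_le_one √n (t - 1) y)
    constructor <;> linarith
  have hpre : ∀ t (y y' : ℕ → ℕ), (∀ i ∈ Finset.Icc 1 (t - 1), y i = y' i) →
      (1 + switchBias √n (t - 1) y) / 2 = (1 + switchBias √n (t - 1) y') / 2 :=
    fun t y y' h => by rw [switchBias_congr _ h]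
  have hbdd : BddBelow { v : ℝ | ∃ a : ℕ → (ℕ → ℕ) → ℝ,
      (∀ t (y : ℕ → ℕ), a t y ∈ Set.Icc (0 : ℝ) 1) ∧
      (∀ t (y y' : ℕ → ℕ), (∀ i ∈ Finset.Icc 1 (t - 1), y i = y' i) → a t y = a t y') ∧
      v = competitiveRatio n a } := by
    refine ⟨2 * minimaxRegret n / (cubeAvg n (fun y =>
      min |(walk (extSeq n y) n : ℝ)| (2 * minimaxRegret n)) + 1), ?_⟩
    rintro v ⟨a, h1, h2, rfl⟩
    exact minimaxRegret_div_le_competitiveRatio hn hf0 a h1 h2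
  rw [gammaOpt_eq]
  refine (csInf_le hbdd ⟨_, ha, hpre, rfl⟩).trans (ciSup_le fun y => ?_)
  have hY := extSeq_le_one n y
  rw [div_le_iff₀ (min_leadCount_pos hf0 _), loss_switchBias hY, min_sum_extSeq_eq,
    leadCount_eq_visits, Nat.sub_add_cancel hn]
  have hL := le_sum_switchBias hm hY n
  set L := ∑ i ∈ Finset.range n, switchBias √n i (extSeq n y) * (2 * (extSeq n y (i + 1) : ℝ) - 1)
  set Z : ℝ := (visits n 0 (extSeq n y) : ℝ)
  have hZ0 : 0 ≤ Z := Nat.cast_nonneg _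
  have hf' : √n ≤ minimaxRegret n / ε := by rw [le_div_iff₀ hε]; linarith
  have hε' : 5 / 4 / ε * minimaxRegret n = 5 / 4 * (minimaxRegret n / ε) := by ring
  have hK : 0 ≤ 5 / 4 / ε := by positivity
  rw [mul_min_of_nonneg _ _ (by linarith)]
  split_ifs at hL with h
  · refine le_min ?_ ?_ <;> nlinarith
  · have hD : |(walk (extSeq n y) n : ℝ)| ≤ √(√n ^ 2 + (walk (extSeq n y) n : ℝ) ^ 2) :=
      Real.abs_le_sqrt (by nlinarith [sq_nonneg √(n : ℝ)])
    have hn2 : (n : ℝ) * (1 / (2 * √n)) = √n / 2 := by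
      nth_rewrite 1 [← Real.mul_self_sqrt (Nat.cast_nonneg n)]
      field_simp
    push Not at h
    refine le_min ?_ ?_ <;> nlinarith

end SwitchingPredictor

section Asymptotics

lemma eventually_mul_sqrt_le_minimaxRegret {c : ℝ} (hc : c < √(2 / Real.pi)) :
    ∀ᶠ n : ℕ in atTop, c * √n ≤ 2 * minimaxRegret n := by
  filter_upwards [eventually_le_cubeAvg_abs_walk hc, eventually_ge_atTop 1] with n h hn
  have hm : 0 < √(n : ℝ) := Real.sqrt_pos.2 (by exact_mod_cast hn)
  rw [inv_mul_eq_div, le_div_iff₀ hm] at h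
  rw [minimaxRegret_eq]
  linarith

lemma isBoundedUnder_le_gammaOpt : IsBoundedUnder (· ≤ ·) atTop gammaOpt := by
  have hκ : 0 < √(2 / Real.pi) := Real.sqrt_pos.2 (by positivity)
  refine ⟨5 / 2 + 5 / 4 / (√(2 / Real.pi) / 4), ?_⟩
  rw [eventually_map]
  filter_upwards [eventually_mul_sqrt_le_minimaxRegret (half_lt_self hκ), eventually_ge_atTop 1]
    with n h hn
  exact gammaOpt_le_of_sqrt_le hn (by positivity) (by linarith)

lemma eventually_div_le_gammaOpt {c : ℝ} (hc0 : 0 < c) (hc : c < √(2 / Real.pi)) :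
    ∀ᶠ n : ℕ in atTop, c / (cubeAvg n (fun y =>
      min ((√n)⁻¹ * |(walk (extSeq n y) n : ℝ)|) √(2 / Real.pi)) + (√n)⁻¹) ≤ gammaOpt n := by
  filter_upwards [eventually_mul_sqrt_le_minimaxRegret hc, eventually_ge_atTop 1] with n h hn
  have hm : 0 < √(n : ℝ) := Real.sqrt_pos.2 (by exact_mod_cast hn)
  have hf : 0 < minimaxRegret n := by nlinarith [mul_pos hc0 hm]
  have hA : 0 ≤ cubeAvg n (fun y =>
      min ((√n)⁻¹ * |(walk (extSeq n y) n : ℝ)|) √(2 / Real.pi)) := by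
    have := cubeAvg_mono n (F := fun _ => (0 : ℝ))
      (G := fun y => min ((√n)⁻¹ * |(walk (extSeq n y) n : ℝ)|) √(2 / Real.pi))
      fun y => le_min (by positivity) (by positivity)
    rwa [cubeAvg_const] at this
  have hB : 0 ≤ cubeAvg n (fun y =>
      min |(walk (extSeq n y) n : ℝ)| (2 * minimaxRegret n)) := by
    have := cubeAvg_mono n (F := fun _ => (0 : ℝ))
      (G := fun y => min |(walk (extSeq n y) n : ℝ)| (2 * minimaxRegret n))
      fun y => le_min (by positivity) (by positivity)
    rwa [cubeAvg_const] at this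
  have hscale : √n ≤ 2 * minimaxRegret n / c := by rw [le_div_iff₀ hc0]; linarith
  have hle : cubeAvg n (fun y => min |(walk (extSeq n y) n : ℝ)| (2 * minimaxRegret n)) + 1 ≤
      2 * minimaxRegret n / c * (cubeAvg n (fun y =>
        min ((√n)⁻¹ * |(walk (extSeq n y) n : ℝ)|) √(2 / Real.pi)) + (√n)⁻¹) := by
    rw [mul_add, ← cubeAvg_const_mul]
    refine add_le_add (cubeAvg_mono n fun y => ?_) ?_
    · rw [mul_min_of_nonneg _ _ (by positivity)]
      refine min_le_min ?_ ?_
      · calc |(walk (extSeq n y) n : ℝ)| = √n * ((√n)⁻¹ * |(walk (extSeq n y) n : ℝ)|) := by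
              field_simp
          _ ≤ _ := by gcongr
      · rw [div_mul_eq_mul_div, le_div_iff₀ hc0]
        gcongr
    · calc (1 : ℝ) = √n * (√n)⁻¹ := by field_simp
        _ ≤ _ := by gcongr
  rw [gammaOpt_eq]
  refine le_csInf ⟨_, fun _ _ => 0, by simp, by simp, rfl⟩ ?_
  rintro v ⟨a, h1, h2, rfl⟩
  refine le_trans ?_ (minimaxRegret_div_le_competitiveRatio hn hf a h1 h2)
  rw [div_le_div_iff₀ (by positivity) (by positivity)]
  calc _ ≤ c * (2 * minimaxRegret n / c * (cubeAvg n (fun y =>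
        min ((√n)⁻¹ * |(walk (extSeq n y) n : ℝ)|) √(2 / Real.pi)) + (√n)⁻¹)) := by gcongr
    _ = _ := by field_simp

end Asymptotics

/-- **Lower bound on the instance-optimal competitive ratio for binary prediction:**
`liminf_{n → ∞} γ_n ≥ (1 - e^{-1/π} + 2 Q(√(2/π)))⁻¹ ≈ 1.4335`. -/
theorem competitive_ratio_lower_bound :
    (1 - Real.exp (-(1 / Real.pi)) + 2 * gaussQ (Real.sqrt (2 / Real.pi)))⁻¹
      ≤ Filter.atTop.liminf (fun n : ℕ => gammaOpt n) := by
  have hπ := Real.pi_pos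
  have hκ : 0 < √(2 / Real.pi) := Real.sqrt_pos.2 (by positivity)
  have hexp : Real.exp (-(1 / Real.pi)) < 1 := by simpa using hπ
  set D := 1 - Real.exp (-(1 / Real.pi)) + 2 * gaussQ √(2 / Real.pi) with hD
  have hD0 : 0 < D := by linarith [gaussQ_nonneg √(2 / Real.pi)]
  have hG : ∫ x, min |x| √(2 / Real.pi) ∂gaussianReal 0 1 = √(2 / Real.pi) * D := by
    rw [integral_min_abs_gaussianReal hκ.le, hD, Real.sq_sqrt (by positivity)]
    ring_nf
  refine le_of_forall_lt fun b hb => ?_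
  obtain ⟨a, hba, ha⟩ := exists_between hb
  refine hba.trans_le (le_liminf_of_le isBoundedUnder_le_gammaOpt.isCoboundedUnder_ge ?_)
  obtain ⟨c, hc1, hc2⟩ := exists_between
    (show max 0 (a * (√(2 / Real.pi) * D)) < √(2 / Real.pi) from max_lt hκ (by
      rw [← one_div, lt_div_iff₀ hD0] at ha
      nlinarith))
  obtain ⟨hc0, hca⟩ := max_lt_iff.1 hc1
  have hlim := (tendsto_cubeAvg_min_abs_walk hκ.le).add
    (tendsto_inv_atTop_zero.comp (Real.tendsto_sqrt_atTop.comp tendsto_natCast_atTop_atTop))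
  rw [hG, add_zero] at hlim
  have hev := ((tendsto_const_nhds (x := c)).div hlim (by positivity)).eventually
    (lt_mem_nhds ((lt_div_iff₀ (by positivity)).2 hca))
  filter_upwards [hev, eventually_div_le_gammaOpt hc0 hc2] with n h1 h2
  exact h1.le.trans h2
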